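/- Let ω be any infinite word and let T = (T_1,…,T_n) be a bilateral weighted shift on K_ω with bounded nonzero complex weights Λ = {λ_u}_{u∈F_ω}. Then every standard basis vector ξ_v (v ∈ F_ω) is a cyclic vector for the unital *-algebra generated by {T_1,…,T_n}: the smallest closed subspace of K_ω containing ξ_v and invariant under every T_i and every T_i* (1 ≤ i ≤ n) is K_ω itself. -/

import Mathlib

open scoped ENNReal InnerProductSpace

noncomputable section

variable {n : ℕ}

/-- The element of the free group determined by a word (list of generators). -/
def wordProd (l : List (Fin n)) : FreeGroup (Fin n) := (l.map FreeGroup.of).prod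

/-- The initial segment `ω_m = i_1 i_2 ⋯ i_m` of an infinite word `ω`. -/
def initSeg (ω : ℕ → Fin n) (m : ℕ) : List (Fin n) := List.ofFn fun j : Fin m => ω j

/-- The set `F_ω = { v ω_m⁻¹ : v ∈ F_n^+, m ≥ 0 }` inside the free group. -/
def Fomega (ω : ℕ → Fin n) : Set (FreeGroup (Fin n)) :=
  {g | ∃ (v : List (Fin n)) (m : ℕ), g = wordProd v * (wordProd (initSeg ω m))⁻¹}

lemma genMul_mem (ω : ℕ → Fin n) (i : Fin n) {g : FreeGroup (Fin n)} (hg : g ∈ Fomega ω) :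
    FreeGroup.of i * g ∈ Fomega ω := by
  obtain ⟨v, m, rfl⟩ := hg
  exact ⟨i :: v, m, by simp [wordProd, mul_assoc]⟩

/-- `K_ω = ℓ²(F_ω)`. -/
abbrev Komega (ω : ℕ → Fin n) : Type _ := lp (fun _ : Fomega ω => ℂ) 2

/-- The standard orthonormal basis vector `ξ_u` of `K_ω`. -/
def xi (ω : ℕ → Fin n) (u : Fomega ω) : Komega ω := lp.single 2 u 1

/-- `iu` as an element of `F_ω`. -/
def gen (ω : ℕ → Fin n) (i : Fin n) (u : Fomega ω) : Fomega ω :=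
  ⟨FreeGroup.of i * u.1, genMul_mem ω i u.2⟩

/-- `T = (T_1,…,T_n)` is the bilateral weighted shift on `K_ω` with (complex) weights `Λ`:
`T_i ξ_u = λ_{iu} ξ_{iu}`. -/
def IsWeightedShift (ω : ℕ → Fin n) (Λ : Fomega ω → ℂ)
    (T : Fin n → Komega ω →L[ℂ] Komega ω) : Prop :=
  ∀ (i : Fin n) (u : Fomega ω), T i (xi ω u) = Λ (gen ω i u) • xi ω (gen ω i u)

/-- real-weight version -/
def IsWeightedShiftR (ω : ℕ → Fin n) (Λ : Fomega ω → ℝ)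
    (T : Fin n → Komega ω →L[ℂ] Komega ω) : Prop :=
  ∀ (i : Fin n) (u : Fomega ω), T i (xi ω u) = (Λ (gen ω i u) : ℂ) • xi ω (gen ω i u)

/-- A closed subspace `H` is reducing for an operator `A` if `H` and `Hᗮ` are `A`-invariant. -/
def Reduces {E : Type*} [NormedAddCommGroup E] [InnerProductSpace ℂ E]
    (A : E →L[ℂ] E) (H : Submodule ℂ E) : Prop :=
  (∀ x ∈ H, A x ∈ H) ∧ ∀ x ∈ Hᗮ, A x ∈ Hᗮ

/-- `w^k` for a finite word `w`. -/
def listPow (w : List (Fin n)) : ℕ → List (Fin n)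
  | 0 => []
  | k + 1 => w ++ listPow w k

/-- A word is primitive if it is non-empty and not a proper power. -/
def Primitive (v : List (Fin n)) : Prop :=
  v ≠ [] ∧ ∀ (w : List (Fin n)) (j : ℕ), 2 ≤ j → v ≠ listPow w j

/-- `ω = v v v ⋯`. -/
def IsPeriodicWord (ω : ℕ → Fin n) (v : List (Fin n)) : Prop :=
  v ≠ [] ∧ ∀ k : ℕ, initSeg ω (k * v.length) = listPow v k

/-- `ω = u v₀ v₀ v₀ ⋯` for some words `u, v₀` with `v₀` non-empty. -/
def EventuallyPeriodic (ω : ℕ → Fin n) : Prop :=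
  ∃ N p : ℕ, 1 ≤ p ∧ ∀ m ≥ N, ω (m + p) = ω m

def Aperiodic (ω : ℕ → Fin n) : Prop := ¬EventuallyPeriodic ω

lemma wordProd_nil : wordProd ([] : List (Fin n)) = 1 := rfl

lemma wordProd_cons (i : Fin n) (l : List (Fin n)) :
    wordProd (i :: l) = FreeGroup.of i * wordProd l := by
  simp [wordProd]

lemma wordProd_initSeg_succ (ω : ℕ → Fin n) (m : ℕ) :
    wordProd (initSeg ω (m + 1)) = wordProd (initSeg ω m) * FreeGroup.of (ω m) := by
  simp only [wordProd, initSeg, List.ofFn_succ_last]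
  simp

lemma one_mem_Fomega (ω : ℕ → Fin n) : (1 : FreeGroup (Fin n)) ∈ Fomega ω :=
  ⟨[], 0, by simp [wordProd, initSeg]⟩

/-- A predicate on `F_ω` invariant under left multiplication by the generators is constant. -/
lemma iff_one_of_forall_gen_iff (ω : ℕ → Fin n) {P : Fomega ω → Prop}
    (hP : ∀ i u, P (gen ω i u) ↔ P u) (u : Fomega ω) :
    P u ↔ P ⟨1, one_mem_Fomega ω⟩ := by
  obtain ⟨_, l, m, rfl⟩ := u
  induction l with
  | cons i l ih =>
    refine Iff.trans ?_ ((hP i _).trans ih)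
    simp only [gen, wordProd_cons, mul_assoc]
  | nil =>
    induction m with
    | zero => simp [wordProd, initSeg]
    | succ m ih =>
      rw [← ih, ← hP (ω m)]
      simp [gen, wordProd_initSeg_succ, wordProd_nil]

lemma gen_injective (ω : ℕ → Fin n) (i : Fin n) : Function.Injective (gen ω i) := by
  intro u w h
  exact Subtype.ext (mul_left_cancel (congrArg Subtype.val h))

lemma inner_xi_left (ω : ℕ → Fin n) (u : Fomega ω) (x : Komega ω) :
    ⟪xi ω u, x⟫_ℂ = x u := by
  simp [xi, lp.inner_single_left]

lemma xi_apply (ω : ℕ → Fin n) (u w : Fomega ω) :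
    xi ω u w = Pi.single (M := fun _ => ℂ) u 1 w := by
  simp [xi, lp.single_apply]

/-- The adjoint of a weighted shift acts by `T_i* ξ_{iu} = conj(λ_{iu}) ξ_u`. -/
lemma IsWeightedShift.star_apply_xi_gen {ω : ℕ → Fin n} {Λ : Fomega ω → ℂ}
    {T : Fin n → Komega ω →L[ℂ] Komega ω} (hT : IsWeightedShift ω Λ T)
    (i : Fin n) (u : Fomega ω) :
    star (T i) (xi ω (gen ω i u)) = star (Λ (gen ω i u)) • xi ω u := by
  ext w
  rw [← inner_xi_left, ContinuousLinearMap.star_eq_adjoint,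
    ContinuousLinearMap.adjoint_inner_right, hT, inner_smul_left, inner_xi_left]
  by_cases h : w = u
  · subst h
    simp [xi_apply]
  · simp [xi_apply, h, (gen_injective ω i).ne h]

lemma eq_top_of_forall_xi_mem {ω : ℕ → Fin n} {H : Submodule ℂ (Komega ω)}
    (hH : IsClosed (H : Set (Komega ω))) (h : ∀ u, xi ω u ∈ H) : H = ⊤ := by
  refine eq_top_iff.2 fun x _ => ?_
  refine hH.mem_of_tendsto (lp.hasSum_single (by simp) x)
    (Filter.Eventually.of_forall fun s => H.sum_mem fun u _ => ?_)
  have hx : lp.single 2 u (x u) = x u • xi ω u := by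
    simp [xi, ← lp.single_smul]
  exact hx ▸ H.smul_mem _ (h u)

/-- every standard basis vector `ξ_v` is cyclic for the unital *-algebra
generated by `{T_1,…,T_n}`: any closed subspace containing `ξ_v` which is invariant under
every `T_i` and every `T_i*` is all of `K_ω`. -/
theorem basis_vector_cyclic_for_star_algebra
    {n : ℕ} (hn : 2 ≤ n) (ω : ℕ → Fin n)
    (Λ : Fomega ω → ℂ) (hbdd : ∃ C : ℝ, ∀ u, ‖Λ u‖ ≤ C) (hnz : ∀ u, Λ u ≠ 0)
    (T : Fin n → Komega ω →L[ℂ] Komega ω) (hT : IsWeightedShift ω Λ T)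
    (v : Fomega ω) (H : Submodule ℂ (Komega ω)) (hH : IsClosed (H : Set (Komega ω)))
    (hv : xi ω v ∈ H)
    (hinv : ∀ i : Fin n, ∀ x ∈ H, T i x ∈ H)
    (hinv' : ∀ i : Fin n, ∀ x ∈ H, star (T i) x ∈ H) :
    H = ⊤ := by
  have hP : ∀ i u, xi ω (gen ω i u) ∈ H ↔ xi ω u ∈ H := by
    intro i u
    constructor
    · intro h
      have h' := hinv' i _ h
      rw [hT.star_apply_xi_gen] at h'
      exact (H.smul_mem_iff (star_ne_zero.2 (hnz _))).1 h'
    · intro h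
      have h' := hinv i _ h
      rw [hT] at h'
      exact (H.smul_mem_iff (hnz _)).1 h'
  have hconst := iff_one_of_forall_gen_iff ω (P := fun u => xi ω u ∈ H) hP
  exact eq_top_of_forall_xi_mem hH fun u => (hconst u).2 ((hconst v).1 hv)
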